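/- arXiv:2311.01381 — 5 statements merged into one kernel-verified Lean document; each statement's English description precedes it below -/
import Mathlib

section
/- Let N ≥ 1, p > 1, and let u : ℝ × EuclideanSpace ℝ (Fin N) → ℝ be smooth with u > 0 everywhere and ∂_t u = Δu + u^p on all of ℝ × ℝ^N. Set v = log u and w = ‖∇v‖² (spatial gradient). Then at every point (t,x): ∂_t w − Δw = −2·Σ_{i,j}(∂_i∂_j v)² + 2(p−1)·u^{p−1}·w + 2·⟨∇v, ∇w⟩. -/
open scoped RealInnerProductSpace

/-- Second partial derivative `∂ᵢ∂ⱼ f` with respect to the standard coordinates. -/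
noncomputable def pd2 {N : ℕ} (f : EuclideanSpace ℝ (Fin N) → ℝ) (i j : Fin N)
    (x : EuclideanSpace ℝ (Fin N)) : ℝ :=
  fderiv ℝ (fun y => fderiv ℝ f y (EuclideanSpace.single i 1)) x (EuclideanSpace.single j 1)

/-- Laplacian: sum of the second partial derivatives `∂ᵢ∂ᵢ f`. -/
noncomputable def lap {N : ℕ} (f : EuclideanSpace ℝ (Fin N) → ℝ)
    (x : EuclideanSpace ℝ (Fin N)) : ℝ :=
  ∑ i, pd2 f i i x

/-- Spatial gradient of a function of `(t, x)`. -/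
noncomputable def sgrad {N : ℕ} (u : ℝ × EuclideanSpace ℝ (Fin N) → ℝ) (t : ℝ)
    (x : EuclideanSpace ℝ (Fin N)) : EuclideanSpace ℝ (Fin N) :=
  gradient (fun y => u (t, y)) x

/-- Spatial second partial derivative of a function of `(t, x)`. -/
noncomputable def spd2 {N : ℕ} (u : ℝ × EuclideanSpace ℝ (Fin N) → ℝ) (i j : Fin N) (t : ℝ)
    (x : EuclideanSpace ℝ (Fin N)) : ℝ :=
  pd2 (fun y => u (t, y)) i j x

/-- Spatial Laplacian of a function of `(t, x)`. -/
noncomputable def slap {N : ℕ} (u : ℝ × EuclideanSpace ℝ (Fin N) → ℝ) (t : ℝ)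
    (x : EuclideanSpace ℝ (Fin N)) : ℝ :=
  lap (fun y => u (t, y)) x

/-- Time derivative `∂ₜ u` of a function of `(t, x)`. -/
noncomputable def partialT {N : ℕ} (u : ℝ × EuclideanSpace ℝ (Fin N) → ℝ) (t : ℝ)
    (x : EuclideanSpace ℝ (Fin N)) : ℝ :=
  deriv (fun s => u (s, x)) t

/-- Directional derivative. -/
noncomputable def dirD {F : Type*} [NormedAddCommGroup F] [NormedSpace ℝ F] (a : F) (f : F → ℝ)
    (z : F) : ℝ := fderiv ℝ f z a

section dirD
variable {F : Type*} [NormedAddCommGroup F] [NormedSpace ℝ F]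

theorem dirD_smooth {f : F → ℝ} (hf : ContDiff ℝ (⊤ : ℕ∞) f) (a : F) :
    ContDiff ℝ (⊤ : ℕ∞) (dirD a f) := by
  unfold dirD
  have h : ContDiff ℝ (⊤ : ℕ∞) (fderiv ℝ f) := hf.fderiv_right (by simp)
  exact h.clm_apply contDiff_const

theorem smooth_diff {f : F → ℝ} (hf : ContDiff ℝ (⊤ : ℕ∞) f) : Differentiable ℝ f :=
  hf.differentiable (by simp)

theorem dirD_comm {f : F → ℝ} (hf : ContDiff ℝ (⊤ : ℕ∞) f) (a b : F) :
    dirD a (dirD b f) = dirD b (dirD a f) := by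
  have h : ContDiff ℝ (⊤ : ℕ∞) (fderiv ℝ f) := hf.fderiv_right (by simp)
  have hd : Differentiable ℝ (fderiv ℝ f) := h.differentiable (by simp)
  funext z
  have key : ∀ a b : F, dirD a (dirD b f) z = fderiv ℝ (fderiv ℝ f) z a b := by
    intro a b
    unfold dirD
    rw [fderiv_clm_apply (hd z) (by fun_prop)]
    simp
  rw [key, key]
  have hs : IsSymmSndFDerivAt ℝ f z := by
    apply hf.contDiffAt.isSymmSndFDerivAt
    simp only [minSmoothness_of_isRCLikeNormedField]
    exact WithTop.coe_le_coe.2 (le_top : (2 : ℕ∞) ≤ ⊤)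
  exact hs a b

theorem dirD_add {f g : F → ℝ} (hf : ContDiff ℝ (⊤ : ℕ∞) f) (hg : ContDiff ℝ (⊤ : ℕ∞) g)
    (a : F) : dirD a (fun z => f z + g z) = fun z => dirD a f z + dirD a g z := by
  funext z
  unfold dirD
  rw [fderiv_fun_add (smooth_diff hf z) (smooth_diff hg z)]
  simp

theorem dirD_mul {f g : F → ℝ} (hf : ContDiff ℝ (⊤ : ℕ∞) f) (hg : ContDiff ℝ (⊤ : ℕ∞) g)
    (a : F) : dirD a (fun z => f z * g z) = fun z => f z * dirD a g z + dirD a f z * g z := by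
  funext z
  unfold dirD
  rw [fderiv_fun_mul (smooth_diff hf z) (smooth_diff hg z)]
  simp [mul_comm]

theorem dirD_sum {ι : Type*} [Fintype ι] {f : ι → F → ℝ}
    (hf : ∀ i, ContDiff ℝ (⊤ : ℕ∞) (f i))
    (a : F) : dirD a (fun z => ∑ i, f i z) = fun z => ∑ i, dirD a (f i) z := by
  funext z
  unfold dirD
  rw [fderiv_fun_sum (fun i _ => smooth_diff (hf i) z)]
  simp

theorem dirD_exp {f : F → ℝ} (hf : ContDiff ℝ (⊤ : ℕ∞) f) (c : ℝ) (a : F) :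
    dirD a (fun z => Real.exp (c * f z)) = fun z => Real.exp (c * f z) * (c * dirD a f z) := by
  funext z
  unfold dirD
  have h := (((smooth_diff hf z).hasFDerivAt.const_mul c).exp).fderiv
  rw [h]
  simp

end dirD

theorem slice_dirD {N : ℕ} {f : ℝ × EuclideanSpace ℝ (Fin N) → ℝ}
    (hf : ContDiff ℝ (⊤ : ℕ∞) f) (t : ℝ) (y a : EuclideanSpace ℝ (Fin N)) :
    fderiv ℝ (fun y => f (t, y)) y a = dirD (0, a) f (t, y) := by
  have h1 : HasFDerivAt (fun y : EuclideanSpace ℝ (Fin N) => (t, y))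
      (ContinuousLinearMap.inr ℝ ℝ (EuclideanSpace ℝ (Fin N))) y :=
    hasFDerivAt_prodMk_right t y
  have h2 := ((smooth_diff hf (t, y)).hasFDerivAt.comp y h1).fderiv
  have h3 : (fun y => f (t, y)) = f ∘ (fun y => (t, y)) := rfl
  rw [h3, h2]
  simp [dirD]

theorem partialT_dirD {N : ℕ} {f : ℝ × EuclideanSpace ℝ (Fin N) → ℝ}
    (hf : ContDiff ℝ (⊤ : ℕ∞) f) (t : ℝ) (y : EuclideanSpace ℝ (Fin N)) :
    partialT f t y = dirD (1, 0) f (t, y) := by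
  have h1 : HasFDerivAt (fun s : ℝ => (s, y))
      (ContinuousLinearMap.inl ℝ ℝ (EuclideanSpace ℝ (Fin N))) t :=
    hasFDerivAt_prodMk_left t y
  have h2 := ((smooth_diff hf (t, y)).hasFDerivAt.comp t h1).fderiv
  have h3 : (fun s => f (s, y)) = f ∘ (fun s => (s, y)) := rfl
  unfold partialT
  rw [← fderiv_apply_one_eq_deriv, h3, h2]
  simp [dirD]

/-- Spatial basis vector. -/
noncomputable def sb {N : ℕ} (i : Fin N) : ℝ × EuclideanSpace ℝ (Fin N) :=
  (0, EuclideanSpace.single i 1)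

theorem spd2_dirD {N : ℕ} {f : ℝ × EuclideanSpace ℝ (Fin N) → ℝ}
    (hf : ContDiff ℝ (⊤ : ℕ∞) f) (i j : Fin N) (t : ℝ) (y : EuclideanSpace ℝ (Fin N)) :
    spd2 f i j t y = dirD (sb j) (dirD (sb i) f) (t, y) := by
  unfold spd2 pd2
  simp only [slice_dirD hf]
  exact slice_dirD (dirD_smooth hf _) t y _

theorem slap_dirD {N : ℕ} {f : ℝ × EuclideanSpace ℝ (Fin N) → ℝ}
    (hf : ContDiff ℝ (⊤ : ℕ∞) f) (t : ℝ) (y : EuclideanSpace ℝ (Fin N)) :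
    slap f t y = ∑ i, dirD (sb i) (dirD (sb i) f) (t, y) := by
  unfold slap lap
  exact Finset.sum_congr rfl (fun i _ => spd2_dirD hf i i t y)

theorem sgrad_apply {N : ℕ} {f : ℝ × EuclideanSpace ℝ (Fin N) → ℝ}
    (hf : ContDiff ℝ (⊤ : ℕ∞) f) (t : ℝ) (y : EuclideanSpace ℝ (Fin N)) (i : Fin N) :
    sgrad f t y i = dirD (sb i) f (t, y) := by
  have h : sgrad f t y i = ⟪sgrad f t y, EuclideanSpace.single i (1 : ℝ)⟫ := by
    simp [EuclideanSpace.inner_single_right]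
  rw [h, sgrad, gradient, InnerProductSpace.toDual_symm_apply]
  exact slice_dirD hf t y _

/-- Evolution equation for `w = ‖∇ log u‖²` for a positive entire solution of
`∂ₜ u = Δu + uᵖ` on `ℝ × ℝ^N`. -/
theorem gradient_log_evolution {N : ℕ} (hN : 1 ≤ N) (p : ℝ) (hp : 1 < p)
    (u : ℝ × EuclideanSpace ℝ (Fin N) → ℝ) (hu : ContDiff ℝ (⊤ : ℕ∞) u)
    (hpos : ∀ z, 0 < u z)
    (heq : ∀ t x, partialT u t x = slap u t x + u (t, x) ^ p)
    (v : ℝ × EuclideanSpace ℝ (Fin N) → ℝ) (hv : v = fun z => Real.log (u z))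
    (w : ℝ × EuclideanSpace ℝ (Fin N) → ℝ) (hw : w = fun z => ‖sgrad v z.1 z.2‖ ^ 2)
    (t : ℝ) (x : EuclideanSpace ℝ (Fin N)) :
    partialT w t x - slap w t x =
      -2 * (∑ i, ∑ j, (spd2 v i j t x) ^ 2)
        + 2 * (p - 1) * u (t, x) ^ (p - 1) * w (t, x)
        + 2 * ⟪sgrad v t x, sgrad w t x⟫ := by
  have hvs : ContDiff ℝ (⊤ : ℕ∞) v := by
    rw [hv]; exact hu.log (fun z => (hpos z).ne')
  have hue : u = fun z => Real.exp (1 * v z) := by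
    funext z; rw [hv]; simp [Real.exp_log (hpos z)]
  have hup : ∀ q z, u z ^ q = Real.exp (q * v z) := by
    intro q z
    rw [hv, Real.rpow_def_of_pos (hpos z), mul_comm]
  have hD := fun i => dirD_smooth hvs (sb (N := N) i)
  have hDD := fun i j => dirD_smooth (hD j) (sb (N := N) i)
  have hw' : w = fun z => ∑ i, dirD (sb i) v z * dirD (sb i) v z := by
    rw [hw]; funext z
    rw [EuclideanSpace.norm_sq_eq]
    refine Finset.sum_congr rfl fun i _ => ?_
    rw [sgrad_apply hvs, Real.norm_eq_abs, sq_abs, sq]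
  have hws : ContDiff ℝ (⊤ : ℕ∞) w := by
    rw [hw']; exact ContDiff.sum fun i _ => (hD i).mul (hD i)
  have hDw : ∀ a, dirD a w = fun z => ∑ k, (dirD (sb k) v z * dirD a (dirD (sb k) v) z
      + dirD a (dirD (sb k) v) z * dirD (sb k) v z) := by
    intro a
    rw [hw', dirD_sum (fun i => (hD i).mul (hD i))]
    funext z
    exact Finset.sum_congr rfl fun k _ => by rw [dirD_mul (hD k) (hD k)]
  have hES : ∀ q : ℝ, ContDiff ℝ (⊤ : ℕ∞) (fun z => Real.exp (q * v z)) :=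
    fun q => (contDiff_const.mul hvs).exp
  have hLs : ContDiff ℝ (⊤ : ℕ∞) (fun z => ∑ i, dirD (sb i) (dirD (sb i) v) z) :=
    ContDiff.sum fun i _ => hDD i i
  -- equation for v
  have hveq : dirD (1, 0) v = fun z => (∑ i, dirD (sb i) (dirD (sb i) v) z + w z)
      + Real.exp ((p - 1) * v z) := by
    funext ⟨s, y⟩
    have h := heq s y
    have h1 : ∀ a, dirD a u = fun z => Real.exp (1 * v z) * dirD a v z := by
      intro a
      conv_lhs => rw [hue]
      rw [dirD_exp hvs]; simp
    rw [partialT_dirD hu, slap_dirD hu, hup] at h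
    simp only [h1] at h
    have h2 : ∀ i, dirD (sb i) (fun z => Real.exp (1 * v z) * dirD (sb i) v z) (s, y)
        = Real.exp (1 * v (s, y)) * (dirD (sb i) (dirD (sb i) v) (s, y)
          + dirD (sb i) v (s, y) * dirD (sb i) v (s, y)) := by
      intro i
      rw [dirD_mul (hES 1) (hD i), dirD_exp hvs]
      ring
    have h3 : Real.exp (p * v (s, y)) =
        Real.exp (1 * v (s, y)) * Real.exp ((p - 1) * v (s, y)) := by
      rw [← Real.exp_add]; ring_nf
    simp only [h2] at h
    rw [← Finset.mul_sum, h3, ← mul_add, Finset.sum_add_distrib] at h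
    have h4 := mul_left_cancel₀ (Real.exp_ne_zero _) h
    rw [h4, hw']
  have hT : ∀ k, dirD (1, 0) (dirD (sb k) v) (t, x) =
      (∑ i, dirD (sb k) (dirD (sb i) (dirD (sb i) v)) (t, x) + dirD (sb k) w (t, x))
      + Real.exp ((p - 1) * v (t, x)) * ((p - 1) * dirD (sb k) v (t, x)) := by
    intro k
    rw [dirD_comm hvs, hveq, dirD_add (hLs.add hws) (hES _), dirD_add hLs hws,
      dirD_exp hvs, dirD_sum (fun i => hDD i i)]
  have hLw : ∀ i, dirD (sb i) (dirD (sb i) w) (t, x) =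
      ∑ k, (2 * (dirD (sb i) (dirD (sb k) v) (t, x)) ^ 2
        + 2 * (dirD (sb k) v (t, x) * dirD (sb k) (dirD (sb i) (dirD (sb i) v)) (t, x))) := by
    intro i
    rw [hDw, dirD_sum (fun k => ((hD k).mul (hDD i k)).add ((hDD i k).mul (hD k)))]
    refine Finset.sum_congr rfl fun k _ => ?_
    rw [dirD_add ((hD k).mul (hDD i k)) ((hDD i k).mul (hD k)), dirD_mul (hD k) (hDD i k),
      dirD_mul (hDD i k) (hD k)]
    have : dirD (sb i) (dirD (sb i) (dirD (sb k) v)) =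
        dirD (sb k) (dirD (sb i) (dirD (sb i) v)) := by
      rw [dirD_comm hvs (sb i) (sb k), dirD_comm (hD i) (sb i) (sb k)]
    rw [this]
    ring
  have hin : ⟪sgrad v t x, sgrad w t x⟫ =
      ∑ k, dirD (sb k) v (t, x) * dirD (sb k) w (t, x) := by
    rw [PiLp.inner_apply]
    refine Finset.sum_congr rfl fun k _ => ?_
    rw [sgrad_apply hvs, sgrad_apply hws]
    simp [mul_comm]
  have hw0 : w (t, x) = ∑ i, dirD (sb i) v (t, x) * dirD (sb i) v (t, x) := by rw [hw']
  rw [partialT_dirD hws, slap_dirD hws, hin, hup]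
  simp only [spd2_dirD hvs, hLw]
  rw [hDw, hw0]
  simp only [hT]
  rw [Finset.sum_comm (f := fun i k => 2 * (dirD (sb i) (dirD (sb k) v) (t, x)) ^ 2
        + 2 * (dirD (sb k) v (t, x) * dirD (sb k) (dirD (sb i) (dirD (sb i) v)) (t, x)))]
  simp only [Finset.mul_sum]
  rw [← Finset.sum_sub_distrib, ← Finset.sum_add_distrib, ← Finset.sum_add_distrib]
  refine Finset.sum_congr rfl fun k _ => ?_
  simp only [Finset.sum_add_distrib, ← Finset.mul_sum]
  ring
end

section
/- Let N ≥ 1 be an integer, p > 1 a real number, and β, γ real constants. Let u : ℝ × EuclideanSpace ℝ (Fin N) → ℝ be smooth with u > 0 everywhere and ∂_t u = Δu + u^p on all of ℝ × ℝ^N. Set v = log u and ρ = ‖∇v‖² − γ·∂_t v + β·u^{p−1}. Then at every point: ∂_t ρ − Δρ = −2·Σ_{i,j}(∂_i∂_j v)² + 2·⟨∇v, ∇ρ⟩ − (γ−β)(p−1)·u^{2p−2} − γ(p−1)·u^{p−1}·Δv − (p−1)(γ−2+βp)·u^{p−1}·‖∇v‖². -/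
open scoped RealInnerProductSpace

section helpers

noncomputable def DD {N : ℕ} (a : ℝ × EuclideanSpace ℝ (Fin N))
    (f : ℝ × EuclideanSpace ℝ (Fin N) → ℝ) : ℝ × EuclideanSpace ℝ (Fin N) → ℝ :=
  fun z => fderiv ℝ f z a

noncomputable def eT (N : ℕ) : ℝ × EuclideanSpace ℝ (Fin N) := (1, 0)

noncomputable def eX {N : ℕ} (i : Fin N) : ℝ × EuclideanSpace ℝ (Fin N) :=
  (0, EuclideanSpace.single i 1)

def Sm {N : ℕ} (f : ℝ × EuclideanSpace ℝ (Fin N) → ℝ) : Prop := ContDiff ℝ (⊤ : ℕ∞) f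

variable {N : ℕ} {f g : ℝ × EuclideanSpace ℝ (Fin N) → ℝ}

theorem Sm.diff (hf : Sm f) : Differentiable ℝ f := ContDiff.differentiable hf (by simp)

theorem Sm.DD (hf : Sm f) (a : ℝ × EuclideanSpace ℝ (Fin N)) : Sm (DD a f) := by
  have h : ContDiff ℝ (⊤ : ℕ∞) (fderiv ℝ f) :=
    ContDiff.fderiv_right (m := (⊤ : ℕ∞)) hf (by simp)
  exact h.clm_apply contDiff_const

theorem DD_comm (hf : Sm f) (a b : ℝ × EuclideanSpace ℝ (Fin N)) :
    DD a (DD b f) = DD b (DD a f) := by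
  have h : Differentiable ℝ (fderiv ℝ f) :=
    (ContDiff.fderiv_right (m := (⊤ : ℕ∞)) hf (by simp)).differentiable (by simp)
  funext z
  have h2 : IsSymmSndFDerivAt ℝ f z := by
    apply ContDiffAt.isSymmSndFDerivAt (n := (⊤ : ℕ∞)) (ContDiff.contDiffAt hf)
    simp only [minSmoothness_of_isRCLikeNormedField]
    exact WithTop.coe_le_coe.2 (le_top : (2 : ℕ∞) ≤ ⊤)
  have key : ∀ a b, DD a (DD b f) z = fderiv ℝ (fderiv ℝ f) z a b := by
    intro a b
    unfold DD
    rw [fderiv_clm_apply (h z) (differentiableAt_const b)]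
    simp
  rw [key, key]
  exact h2 a b

theorem DD_add (hf : Sm f) (hg : Sm g) (a) (z) :
    DD a (fun z => f z + g z) z = DD a f z + DD a g z := by
  unfold DD
  rw [fderiv_fun_add (hf.diff z) (hg.diff z)]; rfl

theorem DD_cmul (hf : Sm f) (c : ℝ) (a) (z) :
    DD a (fun z => c * f z) z = c * DD a f z := by
  unfold DD
  rw [fderiv_const_mul (hf.diff z)]; rfl

theorem DD_mul (hf : Sm f) (hg : Sm g) (a) (z) :
    DD a (fun z => f z * g z) z = f z * DD a g z + DD a f z * g z := by
  unfold DD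
  rw [fderiv_fun_mul (hf.diff z) (hg.diff z)]
  simp [mul_comm]

theorem DD_sq (hf : Sm f) (a) (z) :
    DD a (fun z => f z ^ 2) z = 2 * (f z * DD a f z) := by
  have : (fun z => f z ^ 2) = fun z => f z * f z := by funext z; ring
  rw [this, DD_mul hf hf]; ring

theorem DD_sum {F : Fin N → ℝ × EuclideanSpace ℝ (Fin N) → ℝ} (hF : ∀ i, Sm (F i)) (a) (z) :
    DD a (fun z => ∑ i, F i z) z = ∑ i, DD a (F i) z := by
  unfold DD
  rw [fderiv_fun_sum (fun i _ => (hF i).diff z)]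
  simp

theorem Sm.add (hf : Sm f) (hg : Sm g) : Sm (fun z => f z + g z) := ContDiff.add hf hg
theorem Sm.mul (hf : Sm f) (hg : Sm g) : Sm (fun z => f z * g z) := ContDiff.mul hf hg
theorem Sm.cmul (hf : Sm f) (c : ℝ) : Sm (fun z => c * f z) := ContDiff.mul contDiff_const hf
theorem Sm.sq (hf : Sm f) : Sm (fun z => f z ^ 2) := ContDiff.pow hf 2
theorem Sm.sum {F : Fin N → ℝ × EuclideanSpace ℝ (Fin N) → ℝ} (hF : ∀ i, Sm (F i)) :
    Sm (fun z => ∑ i, F i z) := ContDiff.sum (fun i _ => hF i)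

theorem DD_exp (hf : Sm f) (c : ℝ) (a) (z) :
    DD a (fun z => Real.exp (c * f z)) z = c * (Real.exp (c * f z) * DD a f z) := by
  unfold DD
  have h := ((hf.diff z).hasFDerivAt.const_mul c).exp
  rw [h.fderiv]
  simp
  ring

theorem Sm.exp (hf : Sm f) (c : ℝ) : Sm (fun z => Real.exp (c * f z)) :=
  ContDiff.exp (hf.cmul c)

theorem partialT_eq (hf : Sm f) (t x) : partialT f t x = DD (eT N) f (t, x) := by
  unfold partialT DD eT
  have h1 : HasDerivAt (fun s : ℝ => (s, x)) ((1 : ℝ), (0 : EuclideanSpace ℝ (Fin N))) t :=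
    (hasDerivAt_id t).prodMk (hasDerivAt_const t x)
  exact ((hf.diff (t, x)).hasFDerivAt.comp_hasDerivAt t h1).deriv

theorem sfderiv_eq (hf : Sm f) (t x) (i : Fin N) :
    fderiv ℝ (fun y => f (t, y)) x (EuclideanSpace.single i 1) = DD (eX i) f (t, x) := by
  unfold DD eX
  have h1 : HasFDerivAt (fun y : EuclideanSpace ℝ (Fin N) => (t, y))
      (ContinuousLinearMap.inr ℝ ℝ (EuclideanSpace ℝ (Fin N))) x := hasFDerivAt_prodMk_right t x
  have h2 := (hf.diff (t, x)).hasFDerivAt.comp x h1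
  have h3 : fderiv ℝ (fun y => f (t, y)) x = _ := h2.fderiv
  rw [h3]
  simp

theorem spd2_eq (hf : Sm f) (i j t x) : spd2 f i j t x = DD (eX j) (DD (eX i) f) (t, x) := by
  unfold spd2 pd2
  rw [← sfderiv_eq (hf.DD _)]
  congr 2
  funext y
  exact sfderiv_eq hf t y i

theorem slap_eq (hf : Sm f) (t x) : slap f t x = ∑ i, DD (eX i) (DD (eX i) f) (t, x) := by
  unfold slap lap
  exact Finset.sum_congr rfl fun i _ => spd2_eq hf i i t x

theorem sgrad_coord (hf : Sm f) (t x) (i : Fin N) : sgrad f t x i = DD (eX i) f (t, x) := by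
  rw [← sfderiv_eq hf]
  unfold sgrad
  have h := (inner_gradient_left (f := fun y => f (t, y)) (x := x)
    (y := EuclideanSpace.single i (1:ℝ)))
  rw [← h]
  rw [EuclideanSpace.inner_single_right]
  simp

theorem sgrad_inner (hf : Sm f) (hg : Sm g) (t x) :
    ⟪sgrad f t x, sgrad g t x⟫ = ∑ i, DD (eX i) f (t, x) * DD (eX i) g (t, x) := by
  rw [PiLp.inner_apply]
  refine Finset.sum_congr rfl fun i _ => ?_
  rw [sgrad_coord hf, sgrad_coord hg]
  simp [mul_comm]

theorem sgrad_norm (hf : Sm f) (t x) :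
    ‖sgrad f t x‖ ^ 2 = ∑ i, DD (eX i) f (t, x) ^ 2 := by
  rw [← real_inner_self_eq_norm_sq, sgrad_inner hf hf]
  simp [sq]

end helpers

/-- Evolution equation for `ρ = ‖∇ log u‖² − γ ∂ₜ(log u) + β u^{p−1}` for a positive
entire solution of `∂ₜ u = Δu + uᵖ` on `ℝ × ℝ^N`. -/
theorem rho_evolution {N : ℕ} (hN : 1 ≤ N) (p : ℝ) (hp : 1 < p) (β γ : ℝ)
    (u : ℝ × EuclideanSpace ℝ (Fin N) → ℝ) (hu : ContDiff ℝ (⊤ : ℕ∞) u)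
    (hpos : ∀ z, 0 < u z)
    (heq : ∀ t x, partialT u t x = slap u t x + u (t, x) ^ p)
    (v : ℝ × EuclideanSpace ℝ (Fin N) → ℝ) (hv : v = fun z => Real.log (u z))
    (ρ : ℝ × EuclideanSpace ℝ (Fin N) → ℝ)
    (hρ : ρ = fun z => ‖sgrad v z.1 z.2‖ ^ 2 - γ * partialT v z.1 z.2 + β * u z ^ (p - 1))
    (t : ℝ) (x : EuclideanSpace ℝ (Fin N)) :
    partialT ρ t x - slap ρ t x =
      -2 * (∑ i, ∑ j, (spd2 v i j t x) ^ 2)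
        + 2 * ⟪sgrad v t x, sgrad ρ t x⟫
        - (γ - β) * (p - 1) * u (t, x) ^ (2 * p - 2)
        - γ * (p - 1) * u (t, x) ^ (p - 1) * slap v t x
        - (p - 1) * (γ - 2 + β * p) * u (t, x) ^ (p - 1) * ‖sgrad v t x‖ ^ 2 := by
  have hvS : Sm v := by
    rw [hv]; exact ContDiff.log hu (fun z => (hpos z).ne')
  have hexp : ∀ (c : ℝ) z, u z ^ c = Real.exp (c * v z) := by
    intro c z
    rw [hv, Real.rpow_def_of_pos (hpos z), mul_comm]
  have hu1 : u = fun z => Real.exp (1 * v z) := by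
    funext z; rw [← hexp, Real.rpow_one]
  have huS : Sm u := hu
  set w : ℝ × EuclideanSpace ℝ (Fin N) → ℝ := fun z => Real.exp ((p - 1) * v z) with hw
  have hwS : Sm w := hvS.exp _
  have hDw : ∀ a z, DD a w z = (p - 1) * (w z * DD a v z) := fun a z => DD_exp hvS _ a z
  have hDu : ∀ a z, DD a u z = u z * DD a v z := by
    intro a z
    conv_lhs => rw [hu1]
    rw [DD_exp hvS, one_mul]
    conv_rhs => rw [hu1]
  have hV : ∀ i : Fin N, Sm (DD (eX i) v) := fun i => hvS.DD _
  have hVV : ∀ i : Fin N, Sm (DD (eX i) (DD (eX i) v)) := fun i => (hV i).DD _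
  have hT : Sm (DD (eT N) v) := hvS.DD _
  have key : DD (eT N) v = fun z => (∑ i, DD (eX i) (DD (eX i) v) z) + (∑ i, DD (eX i) v z ^ 2)
      + w z := by
    funext z
    obtain ⟨s, y⟩ := z
    have h := heq s y
    rw [partialT_eq huS, slap_eq huS, hDu] at h
    have h2 : ∀ i : Fin N, DD (eX i) (DD (eX i) u) (s, y) =
        u (s, y) * (DD (eX i) (DD (eX i) v) (s, y) + DD (eX i) v (s, y) ^ 2) := by
      intro i
      have : DD (eX i) u = fun z => u z * DD (eX i) v z := by funext z; exact hDu _ z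
      rw [this, DD_mul huS (hV i), hDu]; ring
    rw [Finset.sum_congr rfl fun i _ => h2 i, ← Finset.mul_sum, Finset.sum_add_distrib] at h
    have h3 : u (s, y) ^ p = u (s, y) * w (s, y) := by
      have : w (s, y) = u (s, y) ^ (p - 1) := (hexp _ _).symm
      rw [this, Real.rpow_sub_one (hpos _).ne']
      field_simp [(hpos (s, y)).ne']
    rw [h3, ← mul_add] at h
    exact mul_left_cancel₀ (hpos _).ne' h
  have hDkey : ∀ a z, DD a (DD (eT N) v) z = (∑ i, DD (eX i) (DD (eX i) (DD a v)) z)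
      + 2 * (∑ i, DD (eX i) v z * DD a (DD (eX i) v) z) + (p - 1) * (w z * DD a v z) := by
    intro a z
    rw [key, DD_add ((Sm.sum hVV).add (Sm.sum fun i => (hV i).sq)) hwS,
      DD_add (Sm.sum hVV) (Sm.sum fun i => (hV i).sq), DD_sum hVV,
      DD_sum (fun i => (hV i).sq), hDw, Finset.mul_sum]
    congr 2
    · refine Finset.sum_congr rfl fun i _ => ?_
      rw [DD_comm (hV i) a, DD_comm hvS a]
    · exact Finset.sum_congr rfl fun i _ => DD_sq (hV i) a z
  have hρ' : ρ = fun z => ((∑ i, DD (eX i) v z ^ 2) + (-γ) * DD (eT N) v z) + β * w z := by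
    rw [hρ]; funext z
    rw [sgrad_norm hvS, partialT_eq hvS, hexp]
    ring
  have hA : Sm (fun z => ∑ i, DD (eX i) v z ^ 2) := Sm.sum fun i => (hV i).sq
  have hρS : Sm ρ := by
    rw [hρ']; exact (hA.add (hT.cmul _)).add (hwS.cmul _)
  have hDρ : ∀ a z, DD a ρ z = ((∑ i, 2 * (DD (eX i) v z * DD a (DD (eX i) v) z))
      + (-γ) * DD a (DD (eT N) v) z) + (β * (p - 1)) * (w z * DD a v z) := by
    intro a z
    rw [hρ', DD_add (hA.add (hT.cmul _)) (hwS.cmul _), DD_add hA (hT.cmul _), DD_cmul hT,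
      DD_cmul hwS, hDw, DD_sum (fun i => (hV i).sq),
      Finset.sum_congr rfl fun i _ => DD_sq (hV i) a z]
    ring
  have hDDρ : ∀ a z, DD a (DD a ρ) z =
      ((∑ i, 2 * (DD (eX i) v z * DD a (DD a (DD (eX i) v)) z + DD a (DD (eX i) v) z ^ 2))
      + (-γ) * DD a (DD a (DD (eT N) v)) z)
      + (β * (p - 1)) * (w z * DD a (DD a v) z + (p - 1) * (w z * DD a v z ^ 2)) := by
    intro a z
    have h1 : ∀ i : Fin N, Sm (fun z => DD (eX i) v z * DD a (DD (eX i) v) z) :=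
      fun i => (hV i).mul ((hV i).DD a)
    have h2 : Sm (fun z => w z * DD a v z) := hwS.mul (hvS.DD a)
    have : DD a ρ = _ := funext (hDρ a)
    rw [this, DD_add ((Sm.sum fun i => (h1 i).cmul 2).add ((hT.DD a).cmul _)) (h2.cmul _),
      DD_add (Sm.sum fun i => (h1 i).cmul 2) ((hT.DD a).cmul _), DD_cmul (hT.DD a),
      DD_cmul h2, DD_mul hwS (hvS.DD a), hDw, DD_sum (fun i => (h1 i).cmul 2)]
    congr 2
    · refine Finset.sum_congr rfl fun i _ => ?_
      rw [DD_cmul (h1 i), DD_mul (hV i) ((hV i).DD a)]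
      ring
    · ring
  have hw2 : u (t, x) ^ (2 * p - 2) = w (t, x) ^ 2 := by
    rw [hexp, hw, sq, ← Real.exp_add]; congr 1; ring
  have hw1 : u (t, x) ^ (p - 1) = w (t, x) := hexp _ _
  rw [hw2, hw1, partialT_eq hρS, slap_eq hρS, sgrad_inner hvS hρS, slap_eq hvS, sgrad_norm hvS,
    Finset.sum_congr rfl fun i _ => Finset.sum_congr rfl fun j _ => by rw [spd2_eq hvS]]
  have k0 := congrFun key (t, x)
  have kT := hDkey (eT N) (t, x)
  have kX : ∀ i : Fin N, DD (eT N) (DD (eX i) v) (t, x) = _ :=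
    fun i => (congrFun (DD_comm hvS (eT N) (eX i)) (t, x)).trans (hDkey (eX i) (t, x))
  have hC : (∑ i, DD (eX i) v (t, x) * DD (eT N) (DD (eX i) v) (t, x)) =
      (∑ i, ∑ j, DD (eX i) v (t, x) * DD (eX j) (DD (eX j) (DD (eX i) v)) (t, x))
      + 2 * (∑ i, ∑ j, DD (eX i) v (t, x) * (DD (eX j) v (t, x) * DD (eX i) (DD (eX j) v) (t, x)))
      + (p - 1) * w (t, x) * ∑ i, DD (eX i) v (t, x) ^ 2 := by
    simp only [Finset.mul_sum, ← Finset.sum_add_distrib]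
    refine Finset.sum_congr rfl fun i _ => ?_
    rw [kX i]
    simp only [mul_add, Finset.mul_sum, Finset.sum_add_distrib]
    congr 1
    · congr 1
      exact Finset.sum_congr rfl fun j _ => by ring
    · ring
  have hL : (∑ j, DD (eX j) (DD (eX j) ρ) (t, x)) =
      2 * (∑ i, ∑ j, DD (eX i) v (t, x) * DD (eX j) (DD (eX j) (DD (eX i) v)) (t, x))
      + 2 * (∑ i, ∑ j, DD (eX j) (DD (eX i) v) (t, x) ^ 2)
      - γ * (∑ j, DD (eX j) (DD (eX j) (DD (eT N) v)) (t, x))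
      + (β * (p - 1)) * (w (t, x) * (∑ j, DD (eX j) (DD (eX j) v) (t, x))
        + (p - 1) * (w (t, x) * ∑ j, DD (eX j) v (t, x) ^ 2)) := by
    rw [Finset.sum_congr rfl fun j _ => hDDρ (eX j) (t, x)]
    simp only [Finset.sum_add_distrib, mul_add, ← Finset.mul_sum]
    rw [Finset.sum_comm, Finset.sum_comm (f := fun (i j : Fin N) =>
      DD (eX i) (DD (eX j) v) (t, x) ^ 2)]
    simp only [← Finset.mul_sum]
    ring
  have hI : (∑ i, DD (eX i) v (t, x) * DD (eX i) ρ (t, x)) =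
      2 * (∑ i, ∑ j, DD (eX i) v (t, x) * (DD (eX j) v (t, x) * DD (eX i) (DD (eX j) v) (t, x)))
      - γ * (∑ i, DD (eX i) v (t, x) * DD (eT N) (DD (eX i) v) (t, x))
      + β * (p - 1) * w (t, x) * ∑ i, DD (eX i) v (t, x) ^ 2 := by
    simp only [Finset.mul_sum, ← Finset.sum_add_distrib, ← Finset.sum_sub_distrib]
    refine Finset.sum_congr rfl fun i _ => ?_
    rw [hDρ, DD_comm hvS (eT N) (eX i)]
    simp only [← Finset.mul_sum]
    ring
  rw [hDρ, hL, hI, kT, ← Finset.mul_sum]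
  rw [hC, k0]
  ring
end

section
/- Let N ≥ 2 be an integer and p a real number with (N+2+√(N²+12N+4))/(2N) ≤ p < min{2, (N+2+√(N²+8N))/(2(N−1))}. Then there exists a real β with 0 < β < min{1/p, 2/(p+2)} such that (p−1)·(2−βp)² − (8(p+1)/(Np))·(2−βp) + 16/(Np) < 0. -/
/-- Case 2 of Lemma 3.1: for `N ≥ 2` and
`(N+2+√(N²+12N+4))/(2N) ≤ p < min{2, (N+2+√(N²+8N))/(2(N−1))}`, there exists
`0 < β < min{1/p, 2/(p+2)}` with `(p−1)(2−βp)² − (8(p+1)/(Np))(2−βp) + 16/(Np) < 0`. -/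
theorem exists_beta_case_two {N : ℕ} (hN : 2 ≤ N) (p : ℝ)
    (hp₁ : ((N : ℝ) + 2 + Real.sqrt ((N : ℝ) ^ 2 + 12 * N + 4)) / (2 * N) ≤ p)
    (hp₂ : p < min 2 (((N : ℝ) + 2 + Real.sqrt ((N : ℝ) ^ 2 + 8 * N)) / (2 * ((N : ℝ) - 1)))) :
    ∃ β : ℝ, 0 < β ∧ β < min (1 / p) (2 / (p + 2)) ∧
      (p - 1) * (2 - β * p) ^ 2 - (8 * (p + 1) / (N * p)) * (2 - β * p) + 16 / (N * p) < 0 := by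
  have hN' : (2 : ℝ) ≤ N := by exact_mod_cast hN
  generalize (N : ℝ) = n at *
  have h2 : p < 2 := lt_of_lt_of_le hp₂ (min_le_left _ _)
  have h3 := lt_of_lt_of_le hp₂ (min_le_right _ _)
  have hs : n ≤ Real.sqrt (n ^ 2 + 12 * n + 4) := Real.le_sqrt_of_sq_le (by nlinarith)
  have ht : n + 1 ≤ Real.sqrt (n ^ 2 + 8 * n) := Real.le_sqrt_of_sq_le (by nlinarith)
  have ht2 : Real.sqrt (n ^ 2 + 8 * n) ^ 2 = n ^ 2 + 8 * n := Real.sq_sqrt (by nlinarith)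
  rw [div_le_iff₀ (by linarith)] at hp₁
  rw [lt_div_iff₀ (by linarith)] at h3
  have h1 : 1 < p := by
    by_contra h
    nlinarith
  have hlow : (n - 1) * 1 < (n - 1) * p := mul_lt_mul_of_pos_left h1 (by linarith)
  have hsq : (2 * (n - 1) * p - (n + 2)) ^ 2 < Real.sqrt (n ^ 2 + 8 * n) ^ 2 :=
    sq_lt_sq' (by linarith) (by linarith)
  rw [ht2] at hsq
  have key : n * p * (p - 1) < (p + 1) ^ 2 := by
    by_contra h
    push Not at h
    have := mul_le_mul_of_nonneg_left h (show (0 : ℝ) ≤ 4 * (n - 1) by linarith)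
    nlinarith
  have hp0 : 0 < p := by linarith
  have hx : 2 - 2 * (p - 1) / (p * (p + 1)) * p = 4 / (p + 1) := by
    field_simp
    ring
  refine ⟨2 * (p - 1) / (p * (p + 1)), ?_, lt_min ?_ ?_, ?_⟩
  · exact div_pos (by linarith) (by positivity)
  · rw [div_lt_div_iff₀ (by positivity) hp0]
    nlinarith
  · rw [div_lt_div_iff₀ (by positivity) (by linarith)]
    nlinarith
  · rw [hx]
    have hn0 : 0 < n := by linarith
    have : (p - 1) * (4 / (p + 1)) ^ 2 - 8 * (p + 1) / (n * p) * (4 / (p + 1)) + 16 / (n * p)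
        = 16 * (n * p * (p - 1) - (p + 1) ^ 2) / (n * p * (p + 1) ^ 2) := by
      field_simp
      ring
    rw [this]
    exact div_neg_of_neg_of_pos (by linarith) (by positivity)
end

section
/- Let N ≥ 2 be an integer and p a real number with p ≥ 2, p < (N+2+√(N²+8N))/(2(N−1)), and (N+2+√(N²+12N+4))/(2N) ≤ p < (N+4+√(N²+24N+16))/(2N). Then there exists a real β with 0 < β < 1/p such that (p−1)·(2−βp)² − (8(p+1)/(Np))·(2−βp) + 16/(Np) < 0. -/
/-- Case 3 of Lemma 3.1: for `N ≥ 2`, `p ≥ 2`, `p < (N+2+√(N²+8N))/(2(N−1))` and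
`(N+2+√(N²+12N+4))/(2N) ≤ p < (N+4+√(N²+24N+16))/(2N)`, there exists `0 < β < 1/p`
with `(p−1)(2−βp)² − (8(p+1)/(Np))(2−βp) + 16/(Np) < 0`. -/
theorem exists_beta_case_three {N : ℕ} (hN : 2 ≤ N) (p : ℝ) (hp₀ : 2 ≤ p)
    (hp₁ : p < ((N : ℝ) + 2 + Real.sqrt ((N : ℝ) ^ 2 + 8 * N)) / (2 * ((N : ℝ) - 1)))
    (hp₂ : ((N : ℝ) + 2 + Real.sqrt ((N : ℝ) ^ 2 + 12 * N + 4)) / (2 * N) ≤ p)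
    (hp₃ : p < ((N : ℝ) + 4 + Real.sqrt ((N : ℝ) ^ 2 + 24 * N + 16)) / (2 * N)) :
    ∃ β : ℝ, 0 < β ∧ β < 1 / p ∧
      (p - 1) * (2 - β * p) ^ 2 - (8 * (p + 1) / (N * p)) * (2 - β * p) + 16 / (N * p) < 0 := by
  have hn : (2 : ℝ) ≤ N := by exact_mod_cast hN
  generalize (N : ℝ) = n at *
  rw [lt_div_iff₀ (by linarith)] at hp₁ hp₃
  rw [div_le_iff₀ (by linarith)] at hp₂
  have h1 : (p * (2 * (n - 1)) - (n + 2)) ^ 2 < n ^ 2 + 8 * n :=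
    (Real.lt_sqrt (by nlinarith)).1 (by linarith)
  have h3 : (p * (2 * n) - (n + 4)) ^ 2 < n ^ 2 + 24 * n + 16 :=
    (Real.lt_sqrt (by nlinarith)).1 (by linarith)
  have h2 : n ^ 2 + 12 * n + 4 ≤ (p * (2 * n) - (n + 2)) ^ 2 :=
    (Real.sqrt_le_iff.1 (by linarith :
      Real.sqrt (n ^ 2 + 12 * n + 4) ≤ p * (2 * n) - (n + 2))).2
  have q1 : n * p * (p - 1) < (p + 1) ^ 2 := by
    have : 4 * (n - 1) * (n * p * (p - 1) - (p + 1) ^ 2) < 0 := by nlinarith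
    by_contra! hc
    have : 0 ≤ 4 * (n - 1) * (n * p * (p - 1) - (p + 1) ^ 2) :=
      mul_nonneg (by linarith) (by linarith)
    linarith
  have q3 : n * p * (p - 1) < 4 * (p + 1) := by
    have : 4 * n * (n * p * (p - 1) - 4 * (p + 1)) < 0 := by nlinarith
    by_contra! hc
    have : 0 ≤ 4 * n * (n * p * (p - 1) - 4 * (p + 1)) :=
      mul_nonneg (by linarith) (by linarith)
    linarith
  have q2 : 2 * (p + 1) ≤ n * p * (p - 1) := by
    have : 0 ≤ 4 * n * (n * p * (p - 1) - 2 * (p + 1)) := by nlinarith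
    have := nonneg_of_mul_nonneg_right this (by linarith)
    linarith
  have hp : 0 < p := by linarith
  have hnp : 0 < n * p := by positivity
  have key : ∃ s : ℝ, 1 < s ∧ s < 2 ∧ n * p * (p - 1) * s ^ 2 - 8 * (p + 1) * s + 16 < 0 := by
    rcases q2.eq_or_lt with h | h
    · refine ⟨3 / 2, by norm_num, by norm_num, ?_⟩
      rw [← h]; linarith
    · have hA : 0 < n * p * (p - 1) := by linarith
      generalize n * p * (p - 1) = A at *
      refine ⟨4 * (p + 1) / A, ?_, ?_, ?_⟩
      · rw [lt_div_iff₀ hA]; linarith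
      · rw [div_lt_iff₀ hA]; linarith
      · have e : A * (4 * (p + 1) / A) ^ 2 - 8 * (p + 1) * (4 * (p + 1) / A) + 16
            = 16 * (A - (p + 1) ^ 2) / A := by
          field_simp; ring
        rw [e]
        exact div_neg_of_neg_of_pos (by linarith) hA
  obtain ⟨s, hs1, hs2, hs⟩ := key
  refine ⟨(2 - s) / p, div_pos (by linarith) hp,
    div_lt_div_of_pos_right (by linarith) hp, ?_⟩
  rw [div_mul_cancel₀ _ hp.ne', sub_sub_cancel]
  have e : (p - 1) * s ^ 2 - 8 * (p + 1) / (n * p) * s + 16 / (n * p)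
      = (n * p * (p - 1) * s ^ 2 - 8 * (p + 1) * s + 16) / (n * p) := by
    field_simp
  rw [e]
  exact div_neg_of_neg_of_pos hs hnp
end

section
/- Let N ≥ 1 be an integer, p a real with 1 < p < p_*(N), and let β > 0, γ > 0 be reals satisfying γ > 1, γ > β, γ > 2 − βp, and γ²(p−1)/(γ−β) < 8/N. Then there exist positive constants α₁, α₂, α₃ (depending only on N, p, β, γ) such that for every smooth positive solution u of ∂_t u = Δu + u^p on ℝ × EuclideanSpace ℝ (Fin N), setting ρ = ‖∇u/u‖² − γ·∂_t(log u) + β·u^{p−1}, at every point where ρ > 0 one has: ∂_t ρ − Δρ ≤ −α₁·(Δ log u)² + 2·⟨∇ log u, ∇ρ⟩ − α₂·ρ² − α₃·‖∇u/u‖⁴. -/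
open scoped RealInnerProductSpace

/-- The critical exponent `p_*(N)`. -/
noncomputable def pStar (N : ℕ) : ℝ :=
  if 2 ≤ N then ((N : ℝ) + 2 + Real.sqrt ((N : ℝ) ^ 2 + 8 * N)) / (2 * ((N : ℝ) - 1)) else 8

namespace RhoAux

/-- directional derivative -/
noncomputable def dd {E : Type*} [NormedAddCommGroup E] [NormedSpace ℝ E] (a : E) (f : E → ℝ) :
    E → ℝ := fun z => fderiv ℝ f z a

section
variable {E : Type*} [NormedAddCommGroup E] [NormedSpace ℝ E] (a b : E) {f g : E → ℝ}

lemma sm_dd (hf : ContDiff ℝ (⊤ : ℕ∞) f) : ContDiff ℝ (⊤ : ℕ∞) (dd a f) := by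
  unfold dd
  exact (hf.fderiv_right (m := (⊤ : ℕ∞)) (by simp)).clm_apply contDiff_const

lemma df (hf : ContDiff ℝ (⊤ : ℕ∞) f) (z : E) : DifferentiableAt ℝ f z :=
  (hf.differentiable (by simp)) z

lemma dd_add (hf : ContDiff ℝ (⊤ : ℕ∞) f) (hg : ContDiff ℝ (⊤ : ℕ∞) g) :
    dd a (fun z => f z + g z) = fun z => dd a f z + dd a g z := by
  funext z
  simp [dd, fderiv_fun_add (df hf z) (df hg z)]

lemma dd_sub (hf : ContDiff ℝ (⊤ : ℕ∞) f) (hg : ContDiff ℝ (⊤ : ℕ∞) g) :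
    dd a (fun z => f z - g z) = fun z => dd a f z - dd a g z := by
  funext z
  simp [dd, fderiv_fun_sub (df hf z) (df hg z)]

lemma dd_mul (hf : ContDiff ℝ (⊤ : ℕ∞) f) (hg : ContDiff ℝ (⊤ : ℕ∞) g) :
    dd a (fun z => f z * g z) = fun z => f z * dd a g z + g z * dd a f z := by
  funext z
  simp [dd, fderiv_fun_mul (df hf z) (df hg z)]

lemma dd_cmul (c : ℝ) (hf : ContDiff ℝ (⊤ : ℕ∞) f) :
    dd a (fun z => c * f z) = fun z => c * dd a f z := by
  funext z
  simp [dd, fderiv_const_mul (df hf z)]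

lemma dd_sum {ι : Type*} (s : Finset ι) {F : ι → E → ℝ}
    (hf : ∀ i, ContDiff ℝ (⊤ : ℕ∞) (F i)) :
    dd a (fun z => ∑ i ∈ s, F i z) = fun z => ∑ i ∈ s, dd a (F i) z := by
  funext z
  simp [dd, fderiv_fun_sum (fun i _ => df (hf i) z)]

lemma dd_exp (hf : ContDiff ℝ (⊤ : ℕ∞) f) :
    dd a (fun z => Real.exp (f z)) = fun z => Real.exp (f z) * dd a f z := by
  funext z
  simp [dd, fderiv_exp (df hf z)]

lemma dd_comm (hf : ContDiff ℝ (⊤ : ℕ∞) f) : dd a (dd b f) = dd b (dd a f) := by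
  have h2 : ContDiff ℝ (⊤ : ℕ∞) (fderiv ℝ f) := hf.fderiv_right (m := (⊤ : ℕ∞)) (by simp)
  have key : ∀ a b z, dd a (dd b f) z = fderiv ℝ (fderiv ℝ f) z a b := by
    intro a b z
    unfold dd
    rw [fderiv_clm_apply ((h2.differentiable (by simp)) z) (differentiableAt_const _)]
    simp
  funext z
  rw [key, key]
  have := (hf.contDiffAt (x := z)).isSymmSndFDerivAt
    (by rw [minSmoothness_of_isRCLikeNormedField]; exact WithTop.coe_le_coe.2 (le_top : (2 : ℕ∞) ≤ ⊤))
  exact this a b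
end

section
variable {N : ℕ}

/-- time direction -/
noncomputable def eT (N : ℕ) : ℝ × EuclideanSpace ℝ (Fin N) := (1, 0)
/-- space direction -/
noncomputable def eX (i : Fin N) : ℝ × EuclideanSpace ℝ (Fin N) :=
  (0, EuclideanSpace.single i 1)

variable {f : ℝ × EuclideanSpace ℝ (Fin N) → ℝ}

lemma partialT_eq (hf : ContDiff ℝ (⊤ : ℕ∞) f) (t : ℝ) (x : EuclideanSpace ℝ (Fin N)) :
    partialT f t x = dd (eT N) f (t, x) := by
  unfold partialT dd eT
  have h1 : HasDerivAt (fun s : ℝ => ((s, x) : ℝ × EuclideanSpace ℝ (Fin N))) (1, 0) t :=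
    (hasDerivAt_id t).prodMk (hasDerivAt_const t x)
  exact ((df hf (t, x)).hasFDerivAt.comp_hasDerivAt t h1).deriv

lemma slice_fderiv (hf : ContDiff ℝ (⊤ : ℕ∞) f) (t : ℝ) (x w : EuclideanSpace ℝ (Fin N)) :
    fderiv ℝ (fun y => f (t, y)) x w = fderiv ℝ f (t, x) (0, w) := by
  have h1 : HasFDerivAt (fun y : EuclideanSpace ℝ (Fin N) => (t, y))
      (ContinuousLinearMap.inr ℝ ℝ (EuclideanSpace ℝ (Fin N))) x :=
    hasFDerivAt_prodMk_right t x
  have := ((df hf (t, x)).hasFDerivAt.comp x h1).fderiv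
  have h2 : (fun y => f (t, y)) = f ∘ (fun y : EuclideanSpace ℝ (Fin N) => (t, y)) := rfl
  rw [h2, this]
  simp

lemma slap_eq (hf : ContDiff ℝ (⊤ : ℕ∞) f) (t : ℝ) (x : EuclideanSpace ℝ (Fin N)) :
    slap f t x = ∑ i, dd (eX i) (dd (eX i) f) (t, x) := by
  unfold slap lap pd2
  refine Finset.sum_congr rfl fun i _ => ?_
  simp_rw [slice_fderiv hf]
  exact slice_fderiv (sm_dd (eX i) hf) t x _

lemma sgrad_eq (hf : ContDiff ℝ (⊤ : ℕ∞) f) (t : ℝ) (x : EuclideanSpace ℝ (Fin N)) (i : Fin N) :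
    sgrad f t x i = dd (eX i) f (t, x) := by
  have h := slice_fderiv hf t x (EuclideanSpace.single i 1)
  unfold sgrad dd eX
  rw [← h, ← inner_gradient_left, EuclideanSpace.inner_single_right]
  simp

end

lemma final_alg (n p β γ : ℝ) (hp : 1 < p) (hγ1 : 1 < γ) (hγβ : β < γ)
    (hγ2 : 2 - β * p < γ) (c : ℝ) (hc : c = 2 / n - (p - 1) * γ ^ 2 / (4 * (γ - β))) (hc0 : 0 < c)
    (D r g w Q L : ℝ) (hr : 0 < r) (hg : 0 ≤ g) (hw : 0 < w)
    (hD : -(γ * D) = r + (γ - 1) * g + (γ - β) * w) (hQ : D ^ 2 / n ≤ Q)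
    (hL : L = -2 * Q + (p - 1) * w * (r + (1 - β * p) * g)) :
    L ≤ -(c / 3) * D ^ 2 - c / (3 * γ ^ 2) * r ^ 2 - c * (γ - 1) ^ 2 / (3 * γ ^ 2) * g ^ 2 := by
  have h1 : (p - 1) * w * (r + (1 - β * p) * g) ≤ (p - 1) * w * (r + (γ - 1) * g) := by
    apply mul_le_mul_of_nonneg_left _ (by nlinarith)
    nlinarith
  have hγβ' : 0 < γ - β := by linarith
  have h2 : w * (r + (γ - 1) * g) ≤ γ ^ 2 * D ^ 2 / (4 * (γ - β)) := by
    rw [le_div_iff₀ (by linarith)]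
    have : γ ^ 2 * D ^ 2 = (r + (γ - 1) * g + (γ - β) * w) ^ 2 := by rw [← hD]; ring
    rw [this]
    nlinarith [sq_nonneg (r + (γ - 1) * g - (γ - β) * w)]
  have h3 : (p - 1) * w * (r + (γ - 1) * g) ≤ (p - 1) * γ ^ 2 / (4 * (γ - β)) * D ^ 2 := by
    calc _ = (p - 1) * (w * (r + (γ - 1) * g)) := by ring
      _ ≤ (p - 1) * (γ ^ 2 * D ^ 2 / (4 * (γ - β))) :=
        mul_le_mul_of_nonneg_left h2 (by linarith)
      _ = _ := by ring
  have h4 : L ≤ - c * D ^ 2 := by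
    have : - c * D ^ 2 = -2 * (D ^ 2 / n) + (p - 1) * γ ^ 2 / (4 * (γ - β)) * D ^ 2 := by
      rw [hc]; ring
    rw [this, hL]; linarith
  have hgg : 0 ≤ (γ - 1) * g := mul_nonneg (by linarith) hg
  have hww : 0 < (γ - β) * w := mul_pos hγβ' hw
  have hγ : 0 < γ ^ 2 := by positivity
  have e : γ ^ 2 * D ^ 2 = (-(γ * D)) ^ 2 := by ring
  have h5 : c / (3 * γ ^ 2) * r ^ 2 ≤ c / 3 * D ^ 2 := by
    have : r ^ 2 ≤ γ ^ 2 * D ^ 2 := by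
      rw [e]; exact pow_le_pow_left₀ hr.le (by linarith) 2
    calc _ ≤ c / (3 * γ ^ 2) * (γ ^ 2 * D ^ 2) := by gcongr
      _ = _ := by field_simp
  have h6 : c * (γ - 1) ^ 2 / (3 * γ ^ 2) * g ^ 2 ≤ c / 3 * D ^ 2 := by
    have : ((γ - 1) * g) ^ 2 ≤ γ ^ 2 * D ^ 2 := by
      rw [e]; exact pow_le_pow_left₀ hgg (by linarith) 2
    calc _ = c / (3 * γ ^ 2) * ((γ - 1) * g) ^ 2 := by ring
      _ ≤ c / (3 * γ ^ 2) * (γ ^ 2 * D ^ 2) := by gcongr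
      _ = _ := by field_simp
  linarith

lemma sum_sq_bound {N : ℕ} (hN : 1 ≤ N) (H : Fin N → Fin N → ℝ) :
    (∑ i, H i i) ^ 2 / (N : ℝ) ≤ ∑ i, ∑ j, H i j ^ 2 := by
  have hn : (0 : ℝ) < N := by exact_mod_cast hN
  rw [div_le_iff₀ hn]
  have h1 : (∑ i, H i i) ^ 2 ≤ N * ∑ i, H i i ^ 2 := by
    simpa using sq_sum_le_card_mul_sum_sq (s := Finset.univ) (f := fun i => H i i)
  have h2 : ∑ i, H i i ^ 2 ≤ ∑ i, ∑ j, H i j ^ 2 :=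
    Finset.sum_le_sum fun i _ =>
      Finset.single_le_sum (f := fun j => H i j ^ 2) (fun j _ => sq_nonneg _) (Finset.mem_univ i)
  nlinarith

/-- the evolution identity for `ρ` -/
lemma evol {E : Type*} [NormedAddCommGroup E] [NormedSpace ℝ E] {N : ℕ} (τ : E) (e : Fin N → E)
    (v ρ : E → ℝ) (hv : ContDiff ℝ (⊤ : ℕ∞) v) (q β γ : ℝ)
    (hpde : dd τ v = fun z => (∑ i, dd (e i) (dd (e i) v) z) + (∑ i, dd (e i) v z * dd (e i) v z)
      + Real.exp (q * v z))
    (hρ : ρ = fun z => (∑ i, dd (e i) v z * dd (e i) v z) - γ * dd τ v z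
      + β * Real.exp (q * v z)) (z : E) :
    dd τ ρ z - (∑ i, dd (e i) (dd (e i) ρ) z) - 2 * ∑ i, dd (e i) v z * dd (e i) ρ z =
      -2 * (∑ i, ∑ j, (dd (e i) (dd (e j) v) z) ^ 2)
      + q * Real.exp (q * v z) * (ρ z + (1 - β * (q + 1)) * ∑ i, dd (e i) v z * dd (e i) v z) := by
  have s1 : ∀ a, ContDiff ℝ (⊤ : ℕ∞) (dd a v) := fun a => sm_dd a hv
  have s2 : ∀ a b, ContDiff ℝ (⊤ : ℕ∞) (dd a (dd b v)) := fun a b => sm_dd a (s1 b)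
  have sW : ContDiff ℝ (⊤ : ℕ∞) (fun z => Real.exp (q * v z)) := by fun_prop
  have dW : ∀ a, dd a (fun z => Real.exp (q * v z)) = fun z => Real.exp (q * v z) * (q * dd a v z) := by
    intro a
    rw [dd_exp a (contDiff_const.mul hv), dd_cmul a q hv]
  have sG : ContDiff ℝ (⊤ : ℕ∞) (fun z => ∑ i, dd (e i) v z * dd (e i) v z) :=
    ContDiff.sum fun i _ => (s1 _).mul (s1 _)
  have sD : ContDiff ℝ (⊤ : ℕ∞) (fun z => ∑ i, dd (e i) (dd (e i) v) z) :=
    ContDiff.sum fun i _ => s2 _ _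
  have dG : ∀ a, dd a (fun z => ∑ i, dd (e i) v z * dd (e i) v z) =
      fun z => ∑ i, 2 * (dd (e i) v z * dd a (dd (e i) v) z) := by
    intro a
    rw [dd_sum a _ (fun i => (s1 _).mul (s1 _))]
    funext z
    refine Finset.sum_congr rfl fun i _ => ?_
    rw [dd_mul a (s1 _) (s1 _)]; ring
  have dρ : ∀ a, dd a ρ = fun z => (∑ i, 2 * (dd (e i) v z * dd a (dd (e i) v) z))
      - γ * dd a (dd τ v) z + β * (Real.exp (q * v z) * (q * dd a v z)) := by
    intro a
    rw [hρ, dd_add a (sG.sub (contDiff_const.mul (s1 τ))) (contDiff_const.mul sW),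
      dd_sub a sG (contDiff_const.mul (s1 τ)), dd_cmul a γ (s1 τ), dd_cmul a β sW, dG, dW]
  have dT : ∀ a, dd a (dd τ v) = fun z => (∑ i, dd a (dd (e i) (dd (e i) v)) z)
      + (∑ i, 2 * (dd (e i) v z * dd a (dd (e i) v) z)) + Real.exp (q * v z) * (q * dd a v z) := by
    intro a
    conv_lhs => rw [hpde]
    rw [dd_add a (sD.add sG) sW, dd_add a sD sG, dG, dW, dd_sum a _ (fun i => s2 _ _)]
  have ddρ : ∀ a, dd a (dd a ρ) z = (∑ i, 2 * (dd a (dd (e i) v) z ^ 2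
        + dd (e i) v z * dd a (dd a (dd (e i) v)) z))
      - γ * dd a (dd a (dd τ v)) z + β * q * (Real.exp (q * v z) * dd a (dd a v) z
        + q * Real.exp (q * v z) * dd a v z ^ 2) := by
    intro a
    have t1 : ∀ i, ContDiff ℝ (⊤ : ℕ∞) (fun z => dd (e i) v z * dd a (dd (e i) v) z) :=
      fun i => (s1 _).mul (s2 _ _)
    have t1' : ∀ i, ContDiff ℝ (⊤ : ℕ∞) (fun z => 2 * (dd (e i) v z * dd a (dd (e i) v) z)) :=
      fun i => contDiff_const.mul (t1 i)
    have t2 : ContDiff ℝ (⊤ : ℕ∞) (fun z => ∑ i, 2 * (dd (e i) v z * dd a (dd (e i) v) z)) :=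
      ContDiff.sum fun i _ => t1' i
    have t3 : ContDiff ℝ (⊤ : ℕ∞) (fun z => q * dd a v z) := contDiff_const.mul (s1 a)
    have t4 : ContDiff ℝ (⊤ : ℕ∞) (fun z => γ * dd a (dd τ v) z) := contDiff_const.mul (s2 _ _)
    rw [dρ a, dd_add a (t2.sub t4) (contDiff_const.mul (sW.mul t3)), dd_sub a t2 t4,
      dd_cmul a γ (s2 _ _), dd_cmul a β (sW.mul t3), dd_mul a sW t3, dd_cmul a q (s1 a), dW,
      dd_sum a _ t1']
    have : ∀ i, dd a (fun z => 2 * (dd (e i) v z * dd a (dd (e i) v) z)) z =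
        2 * (dd a (dd (e i) v) z ^ 2 + dd (e i) v z * dd a (dd a (dd (e i) v)) z) := by
      intro i
      rw [dd_cmul a 2 (t1 i), dd_mul a (s1 _) (s2 _ _)]; ring
    simp only [this]
    ring
  -- commutations
  have c1 : ∀ i, dd τ (dd (e i) v) = dd (e i) (dd τ v) := fun i => dd_comm _ _ hv
  have c2 : ∀ i, dd τ (dd (e i) (dd (e i) v)) = dd (e i) (dd (e i) (dd τ v)) := by
    intro i
    rw [dd_comm τ (e i) (s1 _), c1]
  have c3 : ∀ i j, dd (e j) (dd (e i) (dd (e i) v)) = dd (e i) (dd (e i) (dd (e j) v)) := by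
    intro i j
    rw [dd_comm (e j) (e i) (s1 _), dd_comm (e j) (e i) hv]
  have eT := congrFun (dT τ) z
  simp only [c1, c2] at eT
  have eX : ∀ j, dd (e j) (dd τ v) z = (∑ i, dd (e i) (dd (e i) (dd (e j) v)) z)
      + (∑ i, 2 * (dd (e i) v z * dd (e j) (dd (e i) v) z))
      + Real.exp (q * v z) * (q * dd (e j) v z) := by
    intro j
    rw [dT (e j)]
    have h : ∑ i, dd (e j) (dd (e i) (dd (e i) v)) z = ∑ i, dd (e i) (dd (e i) (dd (e j) v)) z :=
      Finset.sum_congr rfl fun i _ => by rw [c3]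
    rw [← h]
  have eρ := congrFun hρ z
  have eP := congrFun hpde z
  have hA : ∑ j, dd (e j) v z * dd (e j) (dd τ v) z =
      (∑ i, ∑ j, dd (e j) v z * dd (e i) (dd (e i) (dd (e j) v)) z)
      + 2 * (∑ i, ∑ j, dd (e i) v z * (dd (e j) v z * dd (e i) (dd (e j) v) z))
      + q * Real.exp (q * v z) * ∑ i, dd (e i) v z * dd (e i) v z := by
    rw [Finset.sum_comm]
    simp only [Finset.mul_sum, ← Finset.sum_add_distrib]
    refine Finset.sum_congr rfl fun j _ => ?_
    rw [eX j]
    simp only [mul_add, Finset.mul_sum, Finset.sum_add_distrib]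
    congr 1
    · congr 1
      refine Finset.sum_congr rfl fun i _ => ?_
      ring
    · ring
  have e1 : dd τ ρ z = 2 * (∑ i, dd (e i) v z * dd (e i) (dd τ v) z) - γ * dd τ (dd τ v) z
      + β * (Real.exp (q * v z) * (q * dd τ v z)) := by
    rw [dρ τ]; simp only [c1, Finset.mul_sum]
  have e2 : ∑ i, dd (e i) (dd (e i) ρ) z = 2 * (∑ i, ∑ j, (dd (e i) (dd (e j) v) z) ^ 2)
      + 2 * (∑ i, ∑ j, dd (e j) v z * dd (e i) (dd (e i) (dd (e j) v)) z)
      - γ * (∑ i, dd (e i) (dd (e i) (dd τ v)) z)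
      + β * q * Real.exp (q * v z) * (∑ i, dd (e i) (dd (e i) v) z)
      + β * q * q * Real.exp (q * v z) * (∑ i, dd (e i) v z * dd (e i) v z) := by
    simp only [ddρ, Finset.mul_sum, ← Finset.sum_add_distrib, ← Finset.sum_sub_distrib]
    refine Finset.sum_congr rfl fun i _ => ?_
    simp only [mul_add, Finset.sum_add_distrib]
    ring
  have e3 : ∑ i, dd (e i) v z * dd (e i) ρ z =
      2 * (∑ i, ∑ j, dd (e i) v z * (dd (e j) v z * dd (e i) (dd (e j) v) z))
      - γ * (∑ i, dd (e i) v z * dd (e i) (dd τ v) z)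
      + β * q * Real.exp (q * v z) * (∑ i, dd (e i) v z * dd (e i) v z) := by
    simp only [dρ, Finset.mul_sum, ← Finset.sum_add_distrib, ← Finset.sum_sub_distrib]
    refine Finset.sum_congr rfl fun i _ => ?_
    simp only [mul_add, mul_sub, Finset.mul_sum]
    congr 1
    · congr 1
      · refine Finset.sum_congr rfl fun j _ => ?_
        ring
      · ring
    · ring
  rw [← Finset.mul_sum] at eT
  rw [e1, e2, e3, eT, eρ, hA]
  rw [hA] at eT
  rw [eP]
  ring
end RhoAux

/-- Lemma 3.1 (Euclidean case): differential inequality for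
`ρ = ‖∇u/u‖² − γ ∂ₜ(log u) + β u^{p−1}` where `ρ > 0`. -/
theorem rho_differential_inequality {N : ℕ} (hN : 1 ≤ N) (p : ℝ) (hp : 1 < p)
    (hp' : p < pStar N) (β γ : ℝ) (hβ : 0 < β) (hγ0 : 0 < γ) (hγ1 : 1 < γ) (hγβ : β < γ)
    (hγ2 : 2 - β * p < γ) (hγ8 : γ ^ 2 * (p - 1) / (γ - β) < 8 / N) :
    ∃ α₁ α₂ α₃ : ℝ, 0 < α₁ ∧ 0 < α₂ ∧ 0 < α₃ ∧
      ∀ u : ℝ × EuclideanSpace ℝ (Fin N) → ℝ, ContDiff ℝ (⊤ : ℕ∞) u → (∀ z, 0 < u z) →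
        (∀ t x, partialT u t x = slap u t x + u (t, x) ^ p) →
        ∀ ρ : ℝ × EuclideanSpace ℝ (Fin N) → ℝ,
          ρ = (fun z => (‖sgrad u z.1 z.2‖ / u z) ^ 2
            - γ * partialT (fun z' => Real.log (u z')) z.1 z.2 + β * u z ^ (p - 1)) →
          ∀ t x, 0 < ρ (t, x) →
            partialT ρ t x - slap ρ t x ≤
              -α₁ * (slap (fun z => Real.log (u z)) t x) ^ 2
                + 2 * ⟪sgrad (fun z => Real.log (u z)) t x, sgrad ρ t x⟫
                - α₂ * ρ (t, x) ^ 2 - α₃ * (‖sgrad u t x‖ / u (t, x)) ^ 4 := by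
  have hn : (0 : ℝ) < N := by exact_mod_cast hN
  have hγβ' : 0 < γ - β := by linarith
  obtain ⟨c, hc⟩ : ∃ c : ℝ, c = 2 / (N : ℝ) - (p - 1) * γ ^ 2 / (4 * (γ - β)) := ⟨_, rfl⟩
  have hc0 : 0 < c := by
    have h : c = (8 / (N : ℝ) - γ ^ 2 * (p - 1) / (γ - β)) / 4 := by
      rw [hc]; field_simp; ring
    rw [h]; linarith
  have hγ1' : 0 < γ - 1 := by linarith
  refine ⟨c / 3, c / (3 * γ ^ 2), c * (γ - 1) ^ 2 / (3 * γ ^ 2), by positivity, by positivity,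
    by positivity, ?_⟩
  intro u hu hpos hpde ρ hρ t x hρpos
  obtain ⟨v, hvdef⟩ : ∃ v : ℝ × EuclideanSpace ℝ (Fin N) → ℝ, v = fun z => Real.log (u z) :=
    ⟨_, rfl⟩
  rw [← hvdef] at hρ ⊢
  have hv : ContDiff ℝ (⊤ : ℕ∞) v := by
    rw [hvdef]; exact hu.log fun z => (hpos z).ne'
  have huv : u = fun z => Real.exp (v z) := by
    funext z; rw [hvdef]; exact (Real.exp_log (hpos z)).symm
  have hpow : ∀ z (r : ℝ), u z ^ r = Real.exp (r * v z) := by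
    intro z r
    rw [Real.rpow_def_of_pos (hpos z), hvdef, mul_comm]
  have du : ∀ a, RhoAux.dd a u = fun z => u z * RhoAux.dd a v z := by
    intro a
    conv_lhs => rw [huv]
    rw [RhoAux.dd_exp a hv, huv]
  have ddu : ∀ a z, RhoAux.dd a (RhoAux.dd a u) z = u z * (RhoAux.dd a (RhoAux.dd a v) z
      + RhoAux.dd a v z * RhoAux.dd a v z) := by
    intro a z
    rw [du, RhoAux.dd_mul a hu (RhoAux.sm_dd a hv), du]; ring
  have hgrad : ∀ z : ℝ × EuclideanSpace ℝ (Fin N), (‖sgrad u z.1 z.2‖ / u z) ^ 2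
      = ∑ i, RhoAux.dd (RhoAux.eX i) v z * RhoAux.dd (RhoAux.eX i) v z := by
    intro z
    rw [div_pow, EuclideanSpace.norm_sq_eq, Finset.sum_div]
    refine Finset.sum_congr rfl fun i _ => ?_
    rw [RhoAux.sgrad_eq hu, du, Real.norm_eq_abs, sq_abs]
    have := (hpos z).ne'
    field_simp
  have hpde' : RhoAux.dd (RhoAux.eT N) v = fun z =>
      (∑ i, RhoAux.dd (RhoAux.eX i) (RhoAux.dd (RhoAux.eX i) v) z)
      + (∑ i, RhoAux.dd (RhoAux.eX i) v z * RhoAux.dd (RhoAux.eX i) v z)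
      + Real.exp ((p - 1) * v z) := by
    funext z
    have h := hpde z.1 z.2
    rw [RhoAux.partialT_eq hu, RhoAux.slap_eq hu, du] at h
    simp only [ddu, ← Finset.mul_sum, Finset.sum_add_distrib] at h
    have h' : u z ^ p = u z * Real.exp ((p - 1) * v z) := by
      rw [← hpow, Real.rpow_sub_one (hpos z).ne']
      have := (hpos z).ne'
      field_simp
    rw [h', ← mul_add] at h
    exact mul_left_cancel₀ (hpos z).ne' h
  have hρ' : ρ = fun z => (∑ i, RhoAux.dd (RhoAux.eX i) v z * RhoAux.dd (RhoAux.eX i) v z)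
      - γ * RhoAux.dd (RhoAux.eT N) v z + β * Real.exp ((p - 1) * v z) := by
    rw [hρ]; funext z
    rw [hgrad, RhoAux.partialT_eq hv, hpow]
  have hρs : ContDiff ℝ (⊤ : ℕ∞) ρ := by
    rw [hρ']
    have s1 : ∀ a, ContDiff ℝ (⊤ : ℕ∞) (RhoAux.dd a v) := fun a => RhoAux.sm_dd a hv
    exact ((ContDiff.sum fun i _ => (s1 _).mul (s1 _)).sub (contDiff_const.mul (s1 _))).add
      (contDiff_const.mul (contDiff_const.mul hv).exp)
  have hev := RhoAux.evol (RhoAux.eT N) RhoAux.eX v ρ hv (p - 1) β γ hpde' hρ' (t, x)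
  have hin : ⟪sgrad v t x, sgrad ρ t x⟫ = ∑ i, RhoAux.dd (RhoAux.eX i) v (t, x)
      * RhoAux.dd (RhoAux.eX i) ρ (t, x) := by
    rw [PiLp.inner_apply]
    refine Finset.sum_congr rfl fun i _ => ?_
    rw [RhoAux.sgrad_eq hv, RhoAux.sgrad_eq hρs]
    simp [mul_comm]
  have hfin := RhoAux.final_alg N p β γ hp hγ1 hγβ hγ2 c hc hc0
    (∑ i, RhoAux.dd (RhoAux.eX i) (RhoAux.dd (RhoAux.eX i) v) (t, x)) (ρ (t, x))
    (∑ i, RhoAux.dd (RhoAux.eX i) v (t, x) * RhoAux.dd (RhoAux.eX i) v (t, x))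
    (Real.exp ((p - 1) * v (t, x))) _ _ hρpos
    (Finset.sum_nonneg fun i _ => mul_self_nonneg _) (Real.exp_pos _)
    (by
      have h1 := congrFun hρ' (t, x)
      have h2 := congrFun hpde' (t, x)
      rw [h1, h2]; ring)
    (RhoAux.sum_sq_bound hN
      (fun i j => RhoAux.dd (RhoAux.eX i) (RhoAux.dd (RhoAux.eX j) v) (t, x)))
    (hev.trans (by ring))
  have h4 : (‖sgrad u t x‖ / u (t, x)) ^ 4 = (∑ i, RhoAux.dd (RhoAux.eX i) v (t, x)
      * RhoAux.dd (RhoAux.eX i) v (t, x)) ^ 2 := by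
    rw [← hgrad (t, x)]; ring
  rw [RhoAux.partialT_eq hρs, RhoAux.slap_eq hρs, RhoAux.slap_eq hv, hin, h4]
  linarith
end
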